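/- For every memoryless stationary team policy π, every rate pair (R_a,R_b) in ℛ(π) (i.e., satisfying R_a<I(T^a;Y|T^b,S), R_b<I(T^b;Y|T^a,S), R_a+R_b<I(T^a,T^b;Y|S) under the joint law induced by π) is achievable for the memoryless FS-MAC with i.i.d. state, causal asymmetric noisy CSIT and complete CSIR; i.e., ℛ(π) ⊆ C_FS. -/

import Mathlib

open scoped BigOperators
open Finset

noncomputable section

/-- Shannon entropy (base 2) of a pmf on a finite type (convention `0 * log 0 = 0`). -/
def ent {α : Type} [Fintype α] (p : α → ℝ) : ℝ :=
  -∑ x, p x * Real.logb 2 (p x)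

/-- `p` is a probability mass function. -/
def isPMF {α : Type} [Fintype α] (p : α → ℝ) : Prop :=
  (∀ x, 0 ≤ p x) ∧ ∑ x, p x = 1

/-- Mutual information `I(A;B)` computed from a joint pmf on `α × β`. -/
def mutInfo {α β : Type} [Fintype α] [Fintype β] (p : α × β → ℝ) : ℝ :=
  ent (fun a => ∑ b, p (a, b)) + ent (fun b => ∑ a, p (a, b)) - ent p

/-- Conditional mutual information `I(A;B|C)` computed from a joint pmf on `α × β × γ`. -/
def condMutInfo {α β γ : Type} [Fintype α] [Fintype β] [Fintype γ]
    (p : α × β × γ → ℝ) : ℝ :=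
  ent (fun ac : α × γ => ∑ b, p (ac.1, b, ac.2))
    + ent (fun bc : β × γ => ∑ a, p (a, bc.1, bc.2))
    - ent p
    - ent (fun c : γ => ∑ a, ∑ b, p (a, b, c))

/-- A two-user memoryless finite-state MAC with i.i.d. state, noisy causal CSIT
(through the kernels `Qa`, `Qb`) and complete CSIR. -/
structure FSMAC (S Sa Sb Xa Xb Y : Type) [Fintype S] [Fintype Sa] [Fintype Sb]
    [Fintype Xa] [Fintype Xb] [Fintype Y] : Type where
  PS : S → ℝ
  Qa : S → Sa → ℝ
  Qb : S → Sb → ℝ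
  chan : Xa → Xb → S → Y → ℝ
  PS_pmf : isPMF PS
  Qa_pmf : ∀ s, isPMF (Qa s)
  Qb_pmf : ∀ s, isPMF (Qb s)
  chan_pmf : ∀ xa xb s, isPMF (chan xa xb s)

variable {S Sa Sb Xa Xb Y : Type} [Fintype S] [Fintype Sa] [Fintype Sb]
  [Fintype Xa] [Fintype Xb] [Fintype Y] [DecidableEq Sa] [DecidableEq Sb]

/-- `P_{Y|T^a,T^b,S}(y|t^a,t^b,s)`: channel kernel at the level of Shannon strategies. -/
def stratKernel (M : FSMAC S Sa Sb Xa Xb Y) (ta : Sa → Xa) (tb : Sb → Xb)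
    (s : S) (y : Y) : ℝ :=
  ∑ sa, ∑ sb, M.Qa s sa * M.Qb s sb * M.chan (ta sa) (tb sb) s y

/-- Joint single-letter law of `((T^a,T^b),Y,S)` induced by a memoryless stationary
team policy `(πa, πb)`. -/
def teamLaw (M : FSMAC S Sa Sb Xa Xb Y) (πa : (Sa → Xa) → ℝ) (πb : (Sb → Xb) → ℝ) :
    ((Sa → Xa) × (Sb → Xb)) × Y × S → ℝ :=
  fun x => M.PS x.2.2 * πa x.1.1 * πb x.1.2 * stratKernel M x.1.1 x.1.2 x.2.2 x.2.1

/-- `I(T^a;Y|T^b,S)` under the team policy law. -/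
def Ia (M : FSMAC S Sa Sb Xa Xb Y) (πa : (Sa → Xa) → ℝ) (πb : (Sb → Xb) → ℝ) : ℝ :=
  condMutInfo (fun x : (Sa → Xa) × Y × ((Sb → Xb) × S) =>
    teamLaw M πa πb ((x.1, x.2.2.1), x.2.1, x.2.2.2))

/-- `I(T^b;Y|T^a,S)` under the team policy law. -/
def Ib (M : FSMAC S Sa Sb Xa Xb Y) (πa : (Sa → Xa) → ℝ) (πb : (Sb → Xb) → ℝ) : ℝ :=
  condMutInfo (fun x : (Sb → Xb) × Y × ((Sa → Xa) × S) =>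
    teamLaw M πa πb ((x.2.2.1, x.1), x.2.1, x.2.2.2))

/-- `I(T^a,T^b;Y|S)` under the team policy law. -/
def Isum (M : FSMAC S Sa Sb Xa Xb Y) (πa : (Sa → Xa) → ℝ) (πb : (Sb → Xb) → ℝ) : ℝ :=
  condMutInfo (teamLaw M πa πb)

/-- The region `ℛ(π)` of a memoryless stationary team policy `π = (πa, πb)`. -/
def rateRegion (M : FSMAC S Sa Sb Xa Xb Y) (πa : (Sa → Xa) → ℝ)
    (πb : (Sb → Xb) → ℝ) : Set (ℝ × ℝ) :=
  {R : ℝ × ℝ | 0 ≤ R.1 ∧ 0 ≤ R.2 ∧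
    R.1 < Ia M πa πb ∧ R.2 < Ib M πa πb ∧ R.1 + R.2 < Isum M πa πb}

/-- A block code with causal encoders (encoder `a` sees `S^a_{[t]}`, encoder `b`
sees `S^b_{[t]}`) and a decoder with complete state information. -/
structure Code (M : FSMAC S Sa Sb Xa Xb Y) (n : ℕ) (Wa Wb : Type) : Type where
  encA : (t : Fin n) → (Fin (t.1 + 1) → Sa) → Wa → Xa
  encB : (t : Fin n) → (Fin (t.1 + 1) → Sb) → Wb → Xb
  dec : (Fin n → S) → (Fin n → Y) → Wa × Wb

/-- Joint pmf on messages, state sequences, noisy-observation sequences and outputs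
induced by a code (messages uniform and independent; memoryless channel and state). -/
def codeProb (M : FSMAC S Sa Sb Xa Xb Y) {n : ℕ} {Wa Wb : Type}
    [Fintype Wa] [Fintype Wb] (C : Code M n Wa Wb) (wa : Wa) (wb : Wb)
    (s : Fin n → S) (sa : Fin n → Sa) (sb : Fin n → Sb) (y : Fin n → Y) : ℝ :=
  (Fintype.card Wa : ℝ)⁻¹ * (Fintype.card Wb : ℝ)⁻¹ *
    ∏ t : Fin n,
      (M.PS (s t) * M.Qa (s t) (sa t) * M.Qb (s t) (sb t) *
        M.chan (C.encA t (fun i => sa (Fin.castLE t.isLt i)) wa)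
          (C.encB t (fun i => sb (Fin.castLE t.isLt i)) wb) (s t) (y t))

open Classical in
/-- Probability of an event under the code-induced joint law. -/
def codePr (M : FSMAC S Sa Sb Xa Xb Y) {n : ℕ} {Wa Wb : Type}
    [Fintype Wa] [Fintype Wb] (C : Code M n Wa Wb)
    (E : Wa → Wb → (Fin n → S) → (Fin n → Sa) → (Fin n → Sb) → (Fin n → Y) → Prop) : ℝ :=
  ∑ wa, ∑ wb, ∑ s, ∑ sa, ∑ sb, ∑ y,
    if E wa wb s sa sb y then codeProb M C wa wb s sa sb y else 0

/-- Average probability of error of a code. -/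
def errProb (M : FSMAC S Sa Sb Xa Xb Y) {n : ℕ} {Wa Wb : Type}
    [Fintype Wa] [Fintype Wb] (C : Code M n Wa Wb) : ℝ :=
  codePr M C (fun wa wb s _ _ y => C.dec s y ≠ (wa, wb))

/-- A rate pair is achievable if for every `ε > 0` and all large enough `n` there is a
code of blocklength `n` with rates at least `(Ra, Rb)` and error probability `≤ ε`. -/
def Achievable (M : FSMAC S Sa Sb Xa Xb Y) (Ra Rb : ℝ) : Prop :=
  0 ≤ Ra ∧ 0 ≤ Rb ∧
    ∀ ε : ℝ, 0 < ε → ∃ N : ℕ, ∀ n : ℕ, N ≤ n →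
      ∃ (Ma Mb : ℕ) (C : Code M n (Fin Ma) (Fin Mb)),
        Ra ≤ Real.logb 2 Ma / n ∧ Rb ≤ Real.logb 2 Mb / n ∧ errProb M C ≤ ε

/-- The capacity region `C_FS`: closure of the set of achievable rate pairs. -/
def capRegion (M : FSMAC S Sa Sb Xa Xb Y) : Set (ℝ × ℝ) :=
  closure {R : ℝ × ℝ | Achievable M R.1 R.2}

/-- `sup_{π_{T^a} ⊗ π_{T^b}} I(T^a,T^b;Y|S)`. -/
def sumRateSup (M : FSMAC S Sa Sb Xa Xb Y) : ℝ :=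
  sSup {x : ℝ | ∃ (πa : (Sa → Xa) → ℝ) (πb : (Sb → Xb) → ℝ),
    isPMF πa ∧ isPMF πb ∧ x = Isum M πa πb}

/-- Binary entropy function (base 2). -/
def binEnt (x : ℝ) : ℝ := -(x * Real.logb 2 x) - (1 - x) * Real.logb 2 (1 - x)

theorem aux_marg {A : Type} [Fintype A] {M : ℕ} (p : A → ℝ) (g : Fin M → A → ℝ) :
    ∑ F : Fin M → A, (∏ i, p (F i)) * ∏ i, g i (F i) = ∏ i, ∑ a, p a * g i a := by
  classical
  rw [Finset.prod_univ_sum]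
  simp [Finset.prod_mul_distrib]

theorem aux_marg1 {A : Type} [Fintype A] {M : ℕ} (p : A → ℝ) (hp : isPMF p) (w : Fin M)
    (h : A → ℝ) :
    ∑ F : Fin M → A, (∏ i, p (F i)) * h (F w) = ∑ a, p a * h a := by
  have := aux_marg p (fun i : Fin M => if i = w then h else fun _ => 1)
  have e : ∀ F : Fin M → A, ∏ i, (if i = w then h else fun _ => 1) (F i) = h (F w) := by
    intro F
    rw [Finset.prod_eq_single w] <;> simp +contextual
  simp only [e] at this
  rw [this, Finset.prod_eq_single w]
  · simp
  · intro i _ hi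
    simp [hi, hp.2]
  · simp

theorem aux_marg2 {A : Type} [Fintype A] {M : ℕ} (p : A → ℝ) (hp : isPMF p) (w w' : Fin M)
    (hw : w' ≠ w) (h h' : A → ℝ) :
    ∑ F : Fin M → A, (∏ i, p (F i)) * (h (F w) * h' (F w'))
      = (∑ a, p a * h a) * ∑ a, p a * h' a := by
  have := aux_marg p (fun i : Fin M => if i = w then h else if i = w' then h' else fun _ => 1)
  have e : ∀ F : Fin M → A, ∏ i, (if i = w then h else if i = w' then h' else fun _ => 1) (F i)
      = h (F w) * h' (F w') := by
    intro F
    rw [Fintype.prod_eq_mul w w' hw.symm]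
    · simp [hw]
    · rintro i ⟨h1, h2⟩
      simp [h1, h2]
  simp only [e] at this
  rw [this, Fintype.prod_eq_mul w w' hw.symm]
  · simp [hw]
  · rintro i ⟨h1, h2⟩
    simp [h1, h2, hp.2]

theorem aux_pi_sum {A : Type} [Fintype A] {M : ℕ} (p : A → ℝ) (hp : isPMF p) :
    ∑ F : Fin M → A, (∏ i, p (F i)) = 1 := by
  have := aux_marg (M := M) p (fun _ _ => 1)
  simpa [hp.2] using this

/-- Existence of a good realization from an average bound. -/
theorem aux_exists {A B : Type} [Fintype A] [Fintype B] (μ : A → ℝ) (ν : B → ℝ)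
    (hμ : isPMF μ) (hν : isPMF ν) (e : A → B → ℝ) (c : ℝ)
    (h : ∑ a, μ a * ∑ b, ν b * e a b ≤ c) : ∃ a b, e a b ≤ c := by
  by_contra! hc
  have h1 : ∀ a, c < ∑ b, ν b * e a b := by
    intro a
    have : ∃ b, ν b ≠ 0 := by
      by_contra! h0
      have := hν.2
      simp [h0] at this
    obtain ⟨b, hb⟩ := this
    calc c = ∑ b, ν b * c := by rw [← Finset.sum_mul, hν.2, one_mul]
      _ < _ := Finset.sum_lt_sum (fun b _ => mul_le_mul_of_nonneg_left (hc a b).le (hν.1 b))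
        ⟨b, Finset.mem_univ _, mul_lt_mul_of_pos_left (hc a b)
          (lt_of_le_of_ne (hν.1 b) (Ne.symm hb))⟩
  have : c < ∑ a, μ a * ∑ b, ν b * e a b := by
    have : ∃ b, μ b ≠ 0 := by
      by_contra! h0
      have := hμ.2
      simp [h0] at this
    obtain ⟨b, hb⟩ := this
    calc c = ∑ b, μ b * c := by rw [← Finset.sum_mul, hμ.2, one_mul]
      _ < _ := Finset.sum_lt_sum (fun b _ => mul_le_mul_of_nonneg_left (h1 b).le (hμ.1 b))
        ⟨b, Finset.mem_univ _, mul_lt_mul_of_pos_left (h1 b)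
          (lt_of_le_of_ne (hμ.1 b) (Ne.symm hb))⟩
  linarith

/-- Chernoff bound for finite alphabets. -/
theorem aux_chernoff {α : Type} [Fintype α] (p : α → ℝ) (hp : isPMF p) (f : α → ℝ)
    (hf : 0 < ∑ x, p x * f x) :
    ∃ r : ℝ, 0 ≤ r ∧ r < 1 ∧ ∀ (n : ℕ) (E : (Fin n → α) → Prop) [DecidablePred E],
      (∀ x, E x → (∀ t, p (x t) ≠ 0) → ∑ t, f (x t) ≤ 0) →
      ∑ x : Fin n → α, (if E x then ∏ t, p (x t) else 0) ≤ r ^ n := by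
  let φ : ℝ → ℝ := fun l => ∑ x, p x * Real.exp (-(l * f x))
  have hφ0 : φ 0 = 1 := by simp [φ, hp.2]
  have hd : HasDerivAt φ (∑ x, p x * (-(f x))) 0 := by
    apply HasDerivAt.fun_sum
    intro x _
    have h1 : HasDerivAt (fun l : ℝ => -(l * f x)) (-(f x)) 0 := by
      simpa using ((hasDerivAt_id (0:ℝ)).mul_const (f x)).fun_neg
    simpa using (h1.exp).const_mul (p x)
  have hneg : ∑ x, p x * (-(f x)) < 0 := by
    simp only [mul_neg, Finset.sum_neg_distrib]; linarith
  have hex : ∃ l : ℝ, 0 < l ∧ φ l < 1 := by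
    have h2 := (hasDerivAt_iff_tendsto_slope.1 hd)
    have h3 := h2.eventually (gt_mem_nhds hneg)
    have h4 : ∀ᶠ l in nhdsWithin (0:ℝ) (Set.Ioi 0), slope φ 0 l < 0 :=
      h3.filter_mono (nhdsWithin_mono _ (fun x hx => ne_of_gt hx))
    obtain ⟨l, hl, hl0⟩ := (h4.and self_mem_nhdsWithin).exists
    have hl0 : 0 < l := hl0
    refine ⟨l, hl0, ?_⟩
    rw [slope_def_field, hφ0, sub_zero] at hl
    by_contra! hcon
    exact absurd hl (not_lt.2 (div_nonneg (by linarith) hl0.le))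
  obtain ⟨l, hl0, hl1⟩ := hex
  refine ⟨φ l, Finset.sum_nonneg fun x _ => mul_nonneg (hp.1 x) (Real.exp_pos _).le, hl1, ?_⟩
  intro n E _ hE
  have key := aux_marg (M := n) p (fun _ x => Real.exp (-(l * f x)))
  rw [Finset.prod_const, Finset.card_univ, Fintype.card_fin] at key
  change _ = φ l ^ n at key
  rw [← key]
  apply Finset.sum_le_sum
  intro x _
  have hpn : 0 ≤ ∏ t, p (x t) := Finset.prod_nonneg fun t _ => hp.1 _
  have hen : 0 ≤ ∏ t, Real.exp (-(l * f (x t))) := Finset.prod_nonneg fun t _ => (Real.exp_pos _).le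
  split_ifs with h
  · by_cases h0 : ∀ t, p (x t) ≠ 0
    · have hs := hE x h h0
      apply le_mul_of_one_le_right hpn
      rw [← Real.exp_sum]
      apply Real.one_le_exp
      rw [Finset.sum_neg_distrib, ← Finset.mul_sum]
      nlinarith
    · push Not at h0
      obtain ⟨t, ht⟩ := h0
      rw [Finset.prod_eq_zero (Finset.mem_univ t) ht]; simp
  · exact mul_nonneg hpn hen

theorem aux_ratio {α : Type} [Fintype α] (p : α → ℝ) (hp : isPMF p) (u v : α → ℝ)
    (hu : ∀ x, p x ≠ 0 → 0 < u x) (hv : ∀ x, p x ≠ 0 → 0 < v x) (τ : ℝ)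
    (hτ : τ < ∑ x, p x * Real.logb 2 (u x / v x)) :
    ∃ r : ℝ, 0 ≤ r ∧ r < 1 ∧ ∀ (n : ℕ) (E : (Fin n → α) → Prop) [DecidablePred E],
      (∀ x, E x → ∏ t, u (x t) ≤ (2:ℝ) ^ (n * τ) * ∏ t, v (x t)) →
      ∑ x : Fin n → α, (if E x then ∏ t, p (x t) else 0) ≤ r ^ n := by
  obtain ⟨r, h0, h1, h2⟩ := aux_chernoff p hp (fun x => Real.logb 2 (u x / v x) - τ) (by
    simp only [mul_sub, Finset.sum_sub_distrib, ← Finset.sum_mul, hp.2]; linarith)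
  refine ⟨r, h0, h1, fun n E _ hE => h2 n E ?_⟩
  intro x hx hpx
  have h3 := hE x hx
  have hu' : ∀ t ∈ Finset.univ, u (x t) ≠ 0 := fun t _ => (hu _ (hpx t)).ne'
  have hv' : ∀ t ∈ Finset.univ, v (x t) ≠ 0 := fun t _ => (hv _ (hpx t)).ne'
  have hup : 0 < ∏ t, u (x t) := Finset.prod_pos fun t _ => hu _ (hpx t)
  have hvp : 0 < ∏ t, v (x t) := Finset.prod_pos fun t _ => hv _ (hpx t)
  have h4 := Real.logb_le_logb_of_le (b := 2) (by norm_num) hup h3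
  rw [Real.logb_mul (by positivity) hvp.ne', Real.logb_rpow (by norm_num) (by norm_num),
    Real.logb_prod _ _ hu', Real.logb_prod _ _ hv'] at h4
  have h5 : ∀ t, Real.logb 2 (u (x t) / v (x t)) = Real.logb 2 (u (x t)) - Real.logb 2 (v (x t)) :=
    fun t => Real.logb_div (hu' t (Finset.mem_univ _)) (hv' t (Finset.mem_univ _))
  simp only [h5, Finset.sum_sub_distrib, Finset.sum_const, Finset.card_univ, Fintype.card_fin,
    nsmul_eq_mul]
  linarith

theorem aux_condMutInfo {A B C : Type} [Fintype A] [Fintype B] [Fintype C]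
    (α : A → ℝ) (r : C → ℝ) (k : A → C → B → ℝ) (hα : isPMF α) 
    (hk : ∀ a c, isPMF (k a c)) :
    condMutInfo (fun x : A × B × C => α x.1 * r x.2.2 * k x.1 x.2.2 x.2.1)
      = ∑ a, ∑ b, ∑ c, α a * r c * k a c b * Real.logb 2 (k a c b / ∑ a', α a' * k a' c b) := by
  have hAC : ∀ a c, ∑ b, α a * r c * k a c b = α a * r c := by
    intro a c; rw [← Finset.mul_sum, (hk a c).2, mul_one]
  have hBC : ∀ b c, ∑ a, α a * r c * k a c b = r c * ∑ a, α a * k a c b := by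
    intro b c; rw [Finset.mul_sum]; exact Finset.sum_congr rfl fun a _ => by ring
  have hC : ∀ c, ∑ a, ∑ b, α a * r c * k a c b = r c := by
    intro c; simp only [hAC]; rw [← Finset.sum_mul, hα.2, one_mul]
  unfold condMutInfo ent
  simp only [hC]
  simp only [hAC, Fintype.sum_prod_type]
  have e1 : ∑ a, ∑ c, α a * r c * Real.logb 2 (α a * r c)
      = ∑ a, ∑ b, ∑ c, α a * r c * k a c b * Real.logb 2 (α a * r c) := by
    refine Finset.sum_congr rfl fun a _ => ?_
    rw [Finset.sum_comm]
    refine Finset.sum_congr rfl fun c _ => ?_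
    rw [← Finset.sum_mul, hAC]
  have e2 : ∑ b, ∑ c, (∑ a, α a * r c * k a c b) * Real.logb 2 (∑ a, α a * r c * k a c b)
      = ∑ a, ∑ b, ∑ c, α a * r c * k a c b * Real.logb 2 (r c * ∑ a, α a * k a c b) := by
    rw [Finset.sum_comm]
    simp only [hBC]
    conv_rhs => rw [Finset.sum_comm]
    rw [Finset.sum_comm]
    refine Finset.sum_congr rfl fun b _ => ?_
    rw [Finset.sum_comm]
    refine Finset.sum_congr rfl fun c _ => ?_
    rw [← Finset.sum_mul, hBC]
  have e3 : ∑ c, r c * Real.logb 2 (r c)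
      = ∑ a, ∑ b, ∑ c, α a * r c * k a c b * Real.logb 2 (r c) := by
    have : ∀ c, r c * Real.logb 2 (r c) = ∑ a, ∑ b, α a * r c * k a c b * Real.logb 2 (r c) := by
      intro c
      simp only [← Finset.sum_mul]
      rw [hC]
    rw [Finset.sum_congr rfl fun c _ => this c, Finset.sum_comm]
    refine Finset.sum_congr rfl fun a _ => ?_
    rw [Finset.sum_comm]
  rw [e1, e2, e3]
  simp only [← Finset.sum_neg_distrib, ← Finset.sum_add_distrib, ← Finset.sum_sub_distrib]
  refine Finset.sum_congr rfl fun a _ => Finset.sum_congr rfl fun b _ =>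
    Finset.sum_congr rfl fun c _ => ?_
  by_cases h : α a * r c * k a c b = 0
  · simp [h]
  · have ha : α a ≠ 0 := fun h' => h (by simp [h'])
    have hc : r c ≠ 0 := fun h' => h (by simp [h'])
    have hkk : k a c b ≠ 0 := fun h' => h (by simp [h'])
    have hq : 0 < ∑ a', α a' * k a' c b := by
      refine Finset.sum_pos' (fun a' _ => mul_nonneg (hα.1 _) ((hk _ _).1 _))
        ⟨a, Finset.mem_univ _, ?_⟩
      exact mul_pos (lt_of_le_of_ne (hα.1 _) ha.symm) (lt_of_le_of_ne ((hk _ _).1 _) hkk.symm)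
    rw [Real.logb_mul (mul_ne_zero ha hc) hkk, Real.logb_mul ha hc, Real.logb_mul hc hq.ne',
      Real.logb_div hkk hq.ne']
    ring

section oneshot
variable {A B Z : Type} [Fintype A] [Fintype B] [Fintype Z]

/-- Competing codeword for one user (averaging over one codebook). -/
theorem aux_term1 {M : ℕ} (p : A → ℝ) (hp : isPMF p) (W g : A → Z → ℝ)
    (hW1 : ∀ a, ∑ z, W a z = 1) (θ : ℝ) (hθ : 0 < θ)
    (hg : ∀ a z, θ * (∑ a', p a' * W a' z) * g a z ≤ W a z)
    (w w' : Fin M) (hw : w' ≠ w) :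
    ∑ F : Fin M → A, (∏ i, p (F i)) * ∑ z, W (F w) z * g (F w') z ≤ 1 / θ := by
  simp only [Finset.mul_sum]
  rw [Finset.sum_comm]
  have : ∀ z, ∑ F : Fin M → A, (∏ i, p (F i)) * (W (F w) z * g (F w') z)
      ≤ (1 / θ) * ∑ a, p a * W a z := by
    intro z
    rw [aux_marg2 p hp w w' hw (fun a => W a z) (fun a => g a z), Finset.mul_sum, Finset.mul_sum]
    refine Finset.sum_le_sum fun a _ => ?_
    have h1 := mul_le_mul_of_nonneg_left (hg a z) (hp.1 a)
    rw [one_div, ← div_eq_inv_mul, le_div_iff₀ hθ]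
    linarith
  refine (Finset.sum_le_sum fun z _ => this z).trans ?_
  rw [← Finset.mul_sum, Finset.sum_comm]
  simp only [← Finset.mul_sum, hW1, mul_one, hp.2, le_refl]

/-- Both codewords wrong. -/
theorem aux_term2 {Ma Mb : ℕ} (pa : A → ℝ) (pb : B → ℝ) (hpa : isPMF pa) (hpb : isPMF pb)
    (W g : A → B → Z → ℝ) (hW1 : ∀ a b, ∑ z, W a b z = 1) (θ : ℝ) (hθ : 0 < θ)
    (hg : ∀ a b z, θ * (∑ a', pa a' * ∑ b', pb b' * W a' b' z) * g a b z ≤ W a b z)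
    (w w' : Fin Ma) (hw : w' ≠ w) (v v' : Fin Mb) (hv : v' ≠ v) :
    ∑ F : Fin Ma → A, (∏ i, pa (F i)) * ∑ G : Fin Mb → B, (∏ i, pb (G i)) *
      ∑ z, W (F w) (G v) z * g (F w') (G v') z ≤ 1 / θ := by
  have e : ∀ F : Fin Ma → A, ∑ G : Fin Mb → B, (∏ i, pb (G i)) *
      ∑ z, W (F w) (G v) z * g (F w') (G v') z
      = ∑ z, (∑ b, pb b * W (F w) b z) * (∑ b, pb b * g (F w') b z) := by
    intro F
    rw [Finset.sum_congr rfl fun G _ => Finset.mul_sum _ _ _]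
    rw [Finset.sum_comm]
    exact Finset.sum_congr rfl fun z _ =>
      aux_marg2 pb hpb v v' hv (fun b => W (F w) b z) (fun b => g (F w') b z)
  simp only [e]
  refine aux_term1 pa hpa (fun a z => ∑ b, pb b * W a b z) (fun a z => ∑ b, pb b * g a b z)
    ?_ θ hθ ?_ w w' hw
  · intro a
    rw [Finset.sum_comm]
    simp only [← Finset.mul_sum, hW1, mul_one, hpb.2]
  · intro a z
    rw [Finset.mul_sum]
    refine Finset.sum_le_sum fun b _ => ?_
    have h1 := mul_le_mul_of_nonneg_left (hg a b z) (hpb.1 b)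
    linarith

open Classical in
theorem aux_oneshot {Ma Mb : ℕ} (hMa : 0 < Ma) (hMb : 0 < Mb)
    (pa : A → ℝ) (pb : B → ℝ) (hpa : isPMF pa) (hpb : isPMF pb)
    (W : A → B → Z → ℝ) (hW0 : ∀ a b z, 0 ≤ W a b z) (hW1 : ∀ a b, ∑ z, W a b z = 1)
    (θa θb θc : ℝ) (hθa : 0 < θa) (hθb : 0 < θb) (hθc : 0 < θc)
    (Good : A → B → Z → Prop)
    (hGa : ∀ a b z, Good a b z → θa * (∑ a', pa a' * W a' b z) ≤ W a b z)
    (hGb : ∀ a b z, Good a b z → θb * (∑ b', pb b' * W a b' z) ≤ W a b z)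
    (hGc : ∀ a b z, Good a b z → θc * (∑ a', pa a' * ∑ b', pb b' * W a' b' z) ≤ W a b z) :
    ∃ (F : Fin Ma → A) (G : Fin Mb → B) (dec : Z → Fin Ma × Fin Mb),
      (Ma : ℝ)⁻¹ * (Mb : ℝ)⁻¹ * ∑ wa, ∑ wb, ∑ z,
        (if dec z ≠ (wa, wb) then W (F wa) (G wb) z else 0)
      ≤ (∑ a, pa a * ∑ b, pb b * ∑ z, (if Good a b z then 0 else W a b z))
        + Ma / θa + Mb / θb + Ma * Mb / θc := by
  set μ : (Fin Ma → A) → ℝ := fun F => ∏ i, pa (F i) with hμ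
  set ν : (Fin Mb → B) → ℝ := fun F => ∏ i, pb (F i) with hν
  have hμp : isPMF μ := ⟨fun F => Finset.prod_nonneg fun i _ => hpa.1 _, aux_pi_sum pa hpa⟩
  have hνp : isPMF ν := ⟨fun F => Finset.prod_nonneg fun i _ => hpb.1 _, aux_pi_sum pb hpb⟩
  let g : A → B → Z → ℝ := fun a b z => if Good a b z then 1 else 0
  have hg0 : ∀ a b z, 0 ≤ g a b z := fun a b z => by simp only [g]; split_ifs <;> norm_num
  have hga : ∀ a b z, θa * (∑ a', pa a' * W a' b z) * g a b z ≤ W a b z := by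
    intro a b z
    by_cases h : Good a b z
    · simpa [g, h] using hGa a b z h
    · simpa [g, h] using hW0 a b z
  have hgb : ∀ a b z, θb * (∑ b', pb b' * W a b' z) * g a b z ≤ W a b z := by
    intro a b z
    by_cases h : Good a b z
    · simpa [g, h] using hGb a b z h
    · simpa [g, h] using hW0 a b z
  have hgc : ∀ a b z, θc * (∑ a', pa a' * ∑ b', pb b' * W a' b' z) * g a b z ≤ W a b z := by
    intro a b z
    by_cases h : Good a b z
    · simpa [g, h] using hGc a b z h
    · simpa [g, h] using hW0 a b z
  let dec : (Fin Ma → A) → (Fin Mb → B) → Z → Fin Ma × Fin Mb := fun F G z =>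
    if h : ∃ w : Fin Ma × Fin Mb, Good (F w.1) (G w.2) z then h.choose else (⟨0, hMa⟩, ⟨0, hMb⟩)
  -- pointwise bound
  have hpt : ∀ F G wa wb z, (if dec F G z ≠ (wa, wb) then W (F wa) (G wb) z else 0)
      ≤ (if Good (F wa) (G wb) z then 0 else W (F wa) (G wb) z)
        + ∑ wa' ∈ univ.erase wa, W (F wa) (G wb) z * g (F wa') (G wb) z
        + ∑ wb' ∈ univ.erase wb, W (F wa) (G wb) z * g (F wa) (G wb') z
        + ∑ wa' ∈ univ.erase wa, ∑ wb' ∈ univ.erase wb,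
            W (F wa) (G wb) z * g (F wa') (G wb') z := by
    intro F G wa wb z
    have hw := hW0 (F wa) (G wb) z
    have hWg : ∀ a b, 0 ≤ W (F wa) (G wb) z * g a b z := fun a b => mul_nonneg hw (hg0 _ _ _)
    have n2 : 0 ≤ ∑ wa' ∈ univ.erase wa, W (F wa) (G wb) z * g (F wa') (G wb) z :=
      Finset.sum_nonneg fun i _ => hWg _ _
    have n3 : 0 ≤ ∑ wb' ∈ univ.erase wb, W (F wa) (G wb) z * g (F wa) (G wb') z :=
      Finset.sum_nonneg fun i _ => hWg _ _
    have n4' : ∀ wa', 0 ≤ ∑ wb' ∈ univ.erase wb, W (F wa) (G wb) z * g (F wa') (G wb') z :=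
      fun wa' => Finset.sum_nonneg fun i _ => hWg _ _
    have n4 : 0 ≤ ∑ wa' ∈ univ.erase wa, ∑ wb' ∈ univ.erase wb,
            W (F wa) (G wb) z * g (F wa') (G wb') z := Finset.sum_nonneg fun i _ => n4' _
    by_cases hgood : Good (F wa) (G wb) z
    swap
    · simp only [hgood, if_false]
      split_ifs <;> linarith
    simp only [hgood, if_true]
    split_ifs with hd
    swap
    · linarith
    have hex : ∃ w : Fin Ma × Fin Mb, Good (F w.1) (G w.2) z := ⟨(wa, wb), hgood⟩
    have hdg : Good (F (dec F G z).1) (G (dec F G z).2) z := by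
      have : dec F G z = hex.choose := dif_pos hex
      rw [this]
      exact hex.choose_spec
    obtain ⟨wa', wb', hdd⟩ : ∃ wa' wb', dec F G z = (wa', wb') := ⟨_, _, rfl⟩
    rw [hdd] at hd hdg
    simp only at hdg
    have hv : W (F wa) (G wb) z = W (F wa) (G wb) z * g (F wa') (G wb') z := by simp [g, hdg]
    by_cases ha : wa' = wa
    · subst ha
      have hb : wb' ≠ wb := fun h => hd (by rw [h])
      have := Finset.single_le_sum
        (f := fun wb' => W (F wa') (G wb) z * g (F wa') (G wb') z)
        (fun i _ => hWg _ _) (Finset.mem_erase.2 ⟨hb, Finset.mem_univ wb'⟩)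
      linarith
    · by_cases hb : wb' = wb
      · subst hb
        have := Finset.single_le_sum
          (f := fun wa' => W (F wa) (G wb') z * g (F wa') (G wb') z)
          (fun i _ => hWg _ _) (Finset.mem_erase.2 ⟨ha, Finset.mem_univ wa'⟩)
        linarith
      · have h1 := Finset.single_le_sum
          (f := fun wb' => W (F wa) (G wb) z * g (F wa') (G wb') z)
          (fun i _ => hWg _ _) (Finset.mem_erase.2 ⟨hb, Finset.mem_univ wb'⟩)
        have h2 := Finset.single_le_sum
          (f := fun wa' => ∑ wb' ∈ univ.erase wb, W (F wa) (G wb) z * g (F wa') (G wb') z)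
          (fun i _ => n4' _) (Finset.mem_erase.2 ⟨ha, Finset.mem_univ wa'⟩)
        linarith
  -- expectation operator
  let Ex : ((Fin Ma → A) → (Fin Mb → B) → ℝ) → ℝ := fun h => ∑ F, μ F * ∑ G, ν G * h F G
  have Ex_mono : ∀ h h', (∀ F G, h F G ≤ h' F G) → Ex h ≤ Ex h' := fun h h' hh =>
    Finset.sum_le_sum fun F _ => mul_le_mul_of_nonneg_left
      (Finset.sum_le_sum fun G _ => mul_le_mul_of_nonneg_left (hh F G) (hνp.1 G)) (hμp.1 F)
  have Ex_add : ∀ h h', Ex (fun F G => h F G + h' F G) = Ex h + Ex h' := by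
    intro h h'
    simp only [Ex, mul_add, Finset.sum_add_distrib]
  have Ex_sum : ∀ {ι : Type} (s : Finset ι) (h : ι → (Fin Ma → A) → (Fin Mb → B) → ℝ),
      Ex (fun F G => ∑ i ∈ s, h i F G) = ∑ i ∈ s, Ex (h i) := by
    intro ι s h
    induction s using Finset.induction_on with
    | empty => simp [Ex]
    | insert i s hi ih => simp only [Finset.sum_insert hi, Ex_add, ih]
  have Ex_swap : ∀ h, Ex h = ∑ G, ν G * ∑ F, μ F * h F G := by
    intro h
    simp only [Ex, Finset.mul_sum]
    rw [Finset.sum_comm]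
    exact Finset.sum_congr rfl fun G _ => Finset.sum_congr rfl fun F _ => by ring
  have Ex_mul : ∀ c h, Ex (fun F G => c * h F G) = c * Ex h := by
    intro c h
    simp only [Ex, Finset.mul_sum]
    exact Finset.sum_congr rfl fun G _ => Finset.sum_congr rfl fun F _ => by ring
  set P0 := ∑ a, pa a * ∑ b, pb b * ∑ z, (if Good a b z then 0 else W a b z) with hP0
  have T1 : ∀ wa wb, Ex (fun F G => ∑ z, if Good (F wa) (G wb) z then 0 else W (F wa) (G wb) z)
      = P0 := by
    intro wa wb
    simp only [Ex, hμ, hν]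
    rw [Finset.sum_congr rfl fun F _ => congrArg _ (aux_marg1 pb hpb wb
      (fun b => ∑ z, if Good (F wa) b z then 0 else W (F wa) b z))]
    exact aux_marg1 pa hpa wa (fun a => ∑ b, pb b * ∑ z, if Good a b z then 0 else W a b z)
  have T2 : ∀ wa wb, ∀ wa' ∈ univ.erase wa,
      Ex (fun F G => ∑ z, W (F wa) (G wb) z * g (F wa') (G wb) z) ≤ 1 / θa := by
    intro wa wb wa' h
    rw [Ex_swap]
    calc _ ≤ ∑ G, ν G * (1 / θa) := Finset.sum_le_sum fun G _ => mul_le_mul_of_nonneg_left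
          (aux_term1 pa hpa (fun a z => W a (G wb) z) (fun a z => g a (G wb) z)
            (fun a => hW1 _ _) θa hθa (fun a z => hga _ _ _) wa wa' (Finset.ne_of_mem_erase h))
          (hνp.1 G)
      _ = _ := by rw [← Finset.sum_mul, hνp.2, one_mul]
  have T3 : ∀ wa wb, ∀ wb' ∈ univ.erase wb,
      Ex (fun F G => ∑ z, W (F wa) (G wb) z * g (F wa) (G wb') z) ≤ 1 / θb := by
    intro wa wb wb' h
    calc _ ≤ ∑ F, μ F * (1 / θb) := Finset.sum_le_sum fun F _ => mul_le_mul_of_nonneg_left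
          (aux_term1 pb hpb (fun b z => W (F wa) b z) (fun b z => g (F wa) b z)
            (fun a => hW1 _ _) θb hθb (fun a z => hgb _ _ _) wb wb' (Finset.ne_of_mem_erase h))
          (hμp.1 F)
      _ = _ := by rw [← Finset.sum_mul, hμp.2, one_mul]
  have T4 : ∀ wa wb, ∀ wa' ∈ univ.erase wa, ∀ wb' ∈ univ.erase wb,
      Ex (fun F G => ∑ z, W (F wa) (G wb) z * g (F wa') (G wb') z) ≤ 1 / θc :=
    fun wa wb wa' h wb' h' => aux_term2 pa pb hpa hpb W g hW1 θc hθc hgc wa wa'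
      (Finset.ne_of_mem_erase h) wb wb' (Finset.ne_of_mem_erase h')
  have hca : ∀ wa : Fin Ma, ((univ.erase wa).card : ℝ) ≤ Ma := by
    intro wa
    have := Finset.card_le_univ (univ.erase wa)
    rw [Fintype.card_fin] at this
    exact_mod_cast this
  have hcb : ∀ wb : Fin Mb, ((univ.erase wb).card : ℝ) ≤ Mb := by
    intro wb
    have := Finset.card_le_univ (univ.erase wb)
    rw [Fintype.card_fin] at this
    exact_mod_cast this
  have main : ∀ wa wb, Ex (fun F G => ∑ z, if dec F G z ≠ (wa, wb) then W (F wa) (G wb) z else 0)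
      ≤ P0 + Ma / θa + Mb / θb + Ma * Mb / θc := by
    intro wa wb
    refine (Ex_mono _ _ fun F G => Finset.sum_le_sum fun z _ => hpt F G wa wb z).trans ?_
    simp only [Finset.sum_add_distrib]
    rw [Ex_add, Ex_add, Ex_add, T1]
    have B2 : Ex (fun F G => ∑ z, ∑ wa' ∈ univ.erase wa, W (F wa) (G wb) z * g (F wa') (G wb) z)
        ≤ Ma / θa := by
      refine (Ex_mono _ (fun F G => ∑ wa' ∈ univ.erase wa, ∑ z, W (F wa) (G wb) z * g (F wa') (G wb) z)
        fun F G => Finset.sum_comm.le).trans ?_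
      rw [Ex_sum]
      refine (Finset.sum_le_card_nsmul _ _ _ (T2 wa wb)).trans ?_
      rw [nsmul_eq_mul, div_eq_mul_one_div (Ma : ℝ)]
      exact mul_le_mul_of_nonneg_right (hca wa) (by positivity)
    have B3 : Ex (fun F G => ∑ z, ∑ wb' ∈ univ.erase wb, W (F wa) (G wb) z * g (F wa) (G wb') z)
        ≤ Mb / θb := by
      refine (Ex_mono _ (fun F G => ∑ wb' ∈ univ.erase wb, ∑ z, W (F wa) (G wb) z * g (F wa) (G wb') z)
        fun F G => Finset.sum_comm.le).trans ?_
      rw [Ex_sum]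
      refine (Finset.sum_le_card_nsmul _ _ _ (T3 wa wb)).trans ?_
      rw [nsmul_eq_mul, div_eq_mul_one_div (Mb : ℝ)]
      exact mul_le_mul_of_nonneg_right (hcb wb) (by positivity)
    have B4 : Ex (fun F G => ∑ z, ∑ wa' ∈ univ.erase wa, ∑ wb' ∈ univ.erase wb,
        W (F wa) (G wb) z * g (F wa') (G wb') z) ≤ Ma * Mb / θc := by
      refine (Ex_mono _ (fun F G => ∑ wa' ∈ univ.erase wa, ∑ wb' ∈ univ.erase wb, ∑ z,
        W (F wa) (G wb) z * g (F wa') (G wb') z) fun F G => (Finset.sum_comm.trans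
          (Finset.sum_congr rfl fun _ _ => Finset.sum_comm)).le).trans ?_
      rw [Ex_sum]
      have : ∀ wa' ∈ univ.erase wa, Ex (fun F G => ∑ wb' ∈ univ.erase wb, ∑ z,
          W (F wa) (G wb) z * g (F wa') (G wb') z) ≤ Mb / θc := by
        intro wa' h
        rw [Ex_sum]
        refine (Finset.sum_le_card_nsmul _ _ _ (T4 wa wb wa' h)).trans ?_
        rw [nsmul_eq_mul, div_eq_mul_one_div (Mb : ℝ)]
        exact mul_le_mul_of_nonneg_right (hcb wb) (by positivity)
      refine (Finset.sum_le_card_nsmul _ _ _ this).trans ?_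
      rw [nsmul_eq_mul, mul_div_assoc]
      exact mul_le_mul_of_nonneg_right (hca wa) (by positivity)
    linarith
  obtain ⟨F, G, h⟩ := aux_exists μ ν hμp hνp (fun F G => (Ma : ℝ)⁻¹ * (Mb : ℝ)⁻¹ *
      ∑ wa, ∑ wb, ∑ z, (if dec F G z ≠ (wa, wb) then W (F wa) (G wb) z else 0))
      (P0 + Ma / θa + Mb / θb + Ma * Mb / θc) (by
    change Ex _ ≤ _
    rw [Ex_mul, Ex_sum]
    have h1 : ∑ wa, Ex (fun F G => ∑ wb, ∑ z,
        (if dec F G z ≠ (wa, wb) then W (F wa) (G wb) z else 0))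
        ≤ ∑ wa : Fin Ma, ∑ wb : Fin Mb, (P0 + Ma / θa + Mb / θb + Ma * Mb / θc) := by
      refine Finset.sum_le_sum fun wa _ => ?_
      rw [Ex_sum]
      exact Finset.sum_le_sum fun wb _ => main wa wb
    refine (mul_le_mul_of_nonneg_left h1 (by positivity)).trans (le_of_eq ?_)
    have : (Ma : ℝ) ≠ 0 := by positivity
    have : (Mb : ℝ) ≠ 0 := by positivity
    simp only [Finset.sum_const, Finset.card_univ, Fintype.card_fin, nsmul_eq_mul]
    field_simp)
  exact ⟨F, G, dec F G, h⟩

end oneshot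

theorem aux_pi2 {A B : Type} [Fintype A] [Fintype B] {n : ℕ} (f : Fin n → A → B → ℝ) :
    ∑ a : Fin n → A, ∑ b : Fin n → B, ∏ t, f t (a t) (b t) = ∏ t, ∑ a, ∑ b, f t a b := by
  classical
  rw [Finset.prod_univ_sum]
  simp only [Finset.prod_univ_sum, Fintype.piFinset_univ]

theorem aux_pair {A B : Type} [Fintype A] [Fintype B] {n : ℕ}
    (H : (Fin n → A) → (Fin n → B) → ℝ) :
    ∑ x : Fin n → A × B, H (fun t => (x t).1) (fun t => (x t).2) = ∑ a, ∑ b, H a b := by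
  rw [← Fintype.sum_prod_type' H]
  exact Fintype.sum_equiv (Equiv.arrowProdEquivProdArrow (Fin n) (fun _ => A) (fun _ => B)) _ _
    (fun x => rfl)

theorem aux_quad {A B S Y : Type} [Fintype A] [Fintype B] [Fintype S] [Fintype Y] {n : ℕ}
    (H : (Fin n → A) → (Fin n → B) → (Fin n → S) → (Fin n → Y) → ℝ) :
    ∑ x : Fin n → A × B × S × Y, H (fun t => (x t).1) (fun t => (x t).2.1)
      (fun t => (x t).2.2.1) (fun t => (x t).2.2.2) = ∑ a, ∑ b, ∑ s, ∑ y, H a b s y := by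
  rw [aux_pair (fun a (x : Fin n → B × S × Y) => H a (fun t => (x t).1)
      (fun t => (x t).2.1) (fun t => (x t).2.2))]
  refine Finset.sum_congr rfl fun a _ => ?_
  rw [aux_pair (fun b (x : Fin n → S × Y) => H a b (fun t => (x t).1) (fun t => (x t).2))]
  refine Finset.sum_congr rfl fun b _ => ?_
  rw [aux_pair (fun s y => H a b s y)]

section final
variable {S Sa Sb Xa Xb Y : Type} [Fintype S] [Fintype Sa] [Fintype Sb]
  [Fintype Xa] [Fintype Xb] [Fintype Y] [DecidableEq Sa] [DecidableEq Sb]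

theorem aux_strat_pmf (M : FSMAC S Sa Sb Xa Xb Y) (ta : Sa → Xa) (tb : Sb → Xb) (s : S) :
    isPMF (stratKernel M ta tb s) := by
  constructor
  · intro y
    exact Finset.sum_nonneg fun sa _ => Finset.sum_nonneg fun sb _ =>
      mul_nonneg (mul_nonneg ((M.Qa_pmf s).1 _) ((M.Qb_pmf s).1 _)) ((M.chan_pmf _ _ _).1 _)
  · unfold stratKernel
    rw [Finset.sum_comm]
    rw [Finset.sum_congr rfl fun sa _ => Finset.sum_comm]
    simp only [← Finset.mul_sum, (M.chan_pmf _ _ _).2, mul_one, (M.Qa_pmf s).2, (M.Qb_pmf s).2]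

/-- One-letter kernel from a pair of strategies to (state, output). -/
def auxW (M : FSMAC S Sa Sb Xa Xb Y) (ta : Sa → Xa) (tb : Sb → Xb) (s : S) (y : Y) : ℝ :=
  M.PS s * stratKernel M ta tb s y

/-- The block code built from codebooks of strategy sequences. -/
def auxCode (M : FSMAC S Sa Sb Xa Xb Y) {n Ma Mb : ℕ} (F : Fin Ma → Fin n → Sa → Xa)
    (G : Fin Mb → Fin n → Sb → Xb)
    (dec : (Fin n → S) × (Fin n → Y) → Fin Ma × Fin Mb) : Code M n (Fin Ma) (Fin Mb) where
  encA t sa w := F w t (sa (Fin.last t.1))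
  encB t sb w := G w t (sb (Fin.last t.1))
  dec s y := dec (s, y)

theorem auxW_nonneg (M : FSMAC S Sa Sb Xa Xb Y) (ta : Sa → Xa) (tb : Sb → Xb) (s : S) (y : Y) :
    0 ≤ auxW M ta tb s y := mul_nonneg (M.PS_pmf.1 s) ((aux_strat_pmf M ta tb s).1 y)

theorem auxW_sum (M : FSMAC S Sa Sb Xa Xb Y) (ta : Sa → Xa) (tb : Sb → Xb) :
    ∑ s, ∑ y, auxW M ta tb s y = 1 := by
  simp only [auxW, ← Finset.mul_sum, (aux_strat_pmf M ta tb _).2, mul_one, M.PS_pmf.2]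

open Classical in
theorem aux_err (M : FSMAC S Sa Sb Xa Xb Y) {n Ma Mb : ℕ} (F : Fin Ma → Fin n → Sa → Xa)
    (G : Fin Mb → Fin n → Sb → Xb)
    (dec : (Fin n → S) × (Fin n → Y) → Fin Ma × Fin Mb) :
    errProb M (auxCode M F G dec) = (Ma : ℝ)⁻¹ * (Mb : ℝ)⁻¹ * ∑ wa, ∑ wb,
      ∑ z : (Fin n → S) × (Fin n → Y), (if dec z ≠ (wa, wb) then
        ∏ t, auxW M (F wa t) (G wb t) (z.1 t) (z.2 t) else 0) := by
  unfold errProb codePr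
  simp only [Finset.mul_sum]
  refine Finset.sum_congr rfl fun wa _ => Finset.sum_congr rfl fun wb _ => ?_
  rw [Fintype.sum_prod_type]
  refine Finset.sum_congr rfl fun s _ => ?_
  rw [Finset.sum_congr rfl fun sa _ => Finset.sum_comm, Finset.sum_comm]
  refine Finset.sum_congr rfl fun y _ => ?_
  by_cases h : dec (s, y) ≠ (wa, wb)
  · simp only [auxCode, h, if_true, codeProb, ne_eq, not_false_eq_true]
    simp only [← Finset.mul_sum, Fintype.card_fin]
    congr 1
    rw [Finset.prod_congr rfl fun t _ => ?_]
    · exact aux_pi2 (fun t sa sb => M.PS (s t) * M.Qa (s t) sa * M.Qb (s t) sb *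
        M.chan (F wa t sa) (G wb t sb) (s t) (y t))
    · simp only [auxW, stratKernel, Finset.mul_sum]
      refine Finset.sum_congr rfl fun _ _ => Finset.sum_congr rfl fun _ _ => by ring
  · simp [auxCode, h]

/-- single-letter joint law on `Ta × Tb × S × Y`. -/
def auxP (M : FSMAC S Sa Sb Xa Xb Y) (πa : (Sa → Xa) → ℝ) (πb : (Sb → Xb) → ℝ) :
    (Sa → Xa) × (Sb → Xb) × S × Y → ℝ :=
  fun x => πa x.1 * πb x.2.1 * auxW M x.1 x.2.1 x.2.2.1 x.2.2.2

variable (M : FSMAC S Sa Sb Xa Xb Y) (πa : (Sa → Xa) → ℝ) (πb : (Sb → Xb) → ℝ)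

theorem auxP_pmf (hπa : isPMF πa) (hπb : isPMF πb) : isPMF (auxP M πa πb) := by
  constructor
  · intro x
    exact mul_nonneg (mul_nonneg (hπa.1 _) (hπb.1 _)) (auxW_nonneg _ _ _ _ _)
  · simp only [auxP, Fintype.sum_prod_type, ← Finset.mul_sum, auxW_sum, mul_one, hπa.2, hπb.2]

theorem aux_Ia (hπa : isPMF πa) :
    Ia M πa πb = ∑ x, auxP M πa πb x * Real.logb 2 (auxW M x.1 x.2.1 x.2.2.1 x.2.2.2 /
      ∑ ta, πa ta * auxW M ta x.2.1 x.2.2.1 x.2.2.2) := by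
  have := aux_condMutInfo (B := Y) (C := (Sb → Xb) × S) πa (fun c => πb c.1 * M.PS c.2)
    (fun a c => stratKernel M a c.1 c.2) hπa (fun a c => aux_strat_pmf _ _ _ _)
  unfold Ia
  rw [show (fun x : (Sa → Xa) × Y × ((Sb → Xb) × S) =>
      teamLaw M πa πb ((x.1, x.2.2.1), x.2.1, x.2.2.2)) = _ from ?_, this]
  swap
  · funext x
    simp only [teamLaw]
    ring
  simp only [Fintype.sum_prod_type]
  refine Finset.sum_congr rfl fun a _ => ?_
  rw [Finset.sum_comm]
  refine Finset.sum_congr rfl fun b _ => ?_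
  rw [Finset.sum_comm]
  refine Finset.sum_congr rfl fun s _ => Finset.sum_congr rfl fun y _ => ?_
  by_cases h : M.PS s = 0
  · simp [auxP, auxW, h]
  · have e : ∑ ta, πa ta * auxW M ta b s y = M.PS s * ∑ ta, πa ta * stratKernel M ta b s y := by
      rw [Finset.mul_sum]
      exact Finset.sum_congr rfl fun _ _ => by simp only [auxW]; ring
    simp only [e, auxP]
    simp only [auxW]
    rw [mul_div_mul_left _ _ h]
    ring

theorem aux_Ib (hπb : isPMF πb) :
    Ib M πa πb = ∑ x, auxP M πa πb x * Real.logb 2 (auxW M x.1 x.2.1 x.2.2.1 x.2.2.2 /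
      ∑ tb, πb tb * auxW M x.1 tb x.2.2.1 x.2.2.2) := by
  have := aux_condMutInfo (B := Y) (C := (Sa → Xa) × S) πb (fun c => πa c.1 * M.PS c.2)
    (fun b c => stratKernel M c.1 b c.2) hπb (fun a c => aux_strat_pmf _ _ _ _)
  unfold Ib
  rw [show (fun x : (Sb → Xb) × Y × ((Sa → Xa) × S) =>
      teamLaw M πa πb ((x.2.2.1, x.1), x.2.1, x.2.2.2)) = _ from ?_, this]
  swap
  · funext x
    simp only [teamLaw]
    ring
  simp only [Fintype.sum_prod_type]
  conv_rhs => rw [Finset.sum_comm]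
  refine Finset.sum_congr rfl fun b _ => ?_
  rw [Finset.sum_comm]
  refine Finset.sum_congr rfl fun a _ => ?_
  rw [Finset.sum_comm]
  refine Finset.sum_congr rfl fun s _ => Finset.sum_congr rfl fun y _ => ?_
  by_cases h : M.PS s = 0
  · simp [auxP, auxW, h]
  · have e : ∑ tb, πb tb * auxW M a tb s y = M.PS s * ∑ tb, πb tb * stratKernel M a tb s y := by
      rw [Finset.mul_sum]
      exact Finset.sum_congr rfl fun _ _ => by simp only [auxW]; ring
    simp only [e, auxP]
    simp only [auxW]
    rw [mul_div_mul_left _ _ h]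
    ring

theorem aux_Isum (hπa : isPMF πa) (hπb : isPMF πb) :
    Isum M πa πb = ∑ x, auxP M πa πb x * Real.logb 2 (auxW M x.1 x.2.1 x.2.2.1 x.2.2.2 /
      ∑ ta, πa ta * ∑ tb, πb tb * auxW M ta tb x.2.2.1 x.2.2.2) := by
  have := aux_condMutInfo (B := Y) (C := S) (fun t : (Sa → Xa) × (Sb → Xb) => πa t.1 * πb t.2)
    M.PS (fun t s => stratKernel M t.1 t.2 s)
    ⟨fun t => mul_nonneg (hπa.1 _) (hπb.1 _), by
      simp only [Fintype.sum_prod_type, ← Finset.mul_sum, hπb.2, mul_one, hπa.2]⟩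
    (fun a c => aux_strat_pmf _ _ _ _)
  unfold Isum
  rw [show teamLaw M πa πb = _ from ?_, this]
  swap
  · funext x
    simp only [teamLaw]
    ring
  simp only [Fintype.sum_prod_type]
  refine Finset.sum_congr rfl fun a _ => Finset.sum_congr rfl fun b _ => ?_
  rw [Finset.sum_comm]
  refine Finset.sum_congr rfl fun s _ => Finset.sum_congr rfl fun y _ => ?_
  by_cases h : M.PS s = 0
  · simp [auxP, auxW, h]
  · have e : ∑ ta, πa ta * ∑ tb, πb tb * auxW M ta tb s y
        = M.PS s * ∑ ta, ∑ tb, πa ta * πb tb * stratKernel M ta tb s y := by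
      simp only [Finset.mul_sum]
      exact Finset.sum_congr rfl fun _ _ => Finset.sum_congr rfl fun _ _ => by
        simp only [auxW]; ring
    simp only [e, auxP]
    simp only [auxW]
    rw [mul_div_mul_left _ _ h]
    ring

theorem aux_ceil (n : ℕ) (R : ℝ) (hR : 0 ≤ R) (hn : 0 < n) :
    0 < ⌈(2:ℝ) ^ (n * R)⌉₊ ∧ R ≤ Real.logb 2 (⌈(2:ℝ) ^ (n * R)⌉₊ : ℕ) / n ∧
      ((⌈(2:ℝ) ^ (n * R)⌉₊ : ℕ) : ℝ) ≤ 2 * (2:ℝ) ^ (n * R) := by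
  have hpos : 0 < (2:ℝ) ^ (n * R) := by positivity
  have h1 : 1 ≤ (2:ℝ) ^ (n * R) := Real.one_le_rpow (by norm_num) (by positivity)
  refine ⟨Nat.ceil_pos.2 hpos, ?_, ?_⟩
  · have hn' : (0:ℝ) < n := by exact_mod_cast hn
    rw [le_div_iff₀ hn']
    have := Real.logb_le_logb_of_le (b := 2) (by norm_num) hpos (Nat.le_ceil _)
    rw [Real.logb_rpow (by norm_num) (by norm_num)] at this
    linarith
  · have := (Nat.ceil_lt_add_one hpos.le).le
    linarith

theorem aux_pow (n : ℕ) (x y : ℝ) : (2:ℝ) ^ (n * x) / (2:ℝ) ^ (n * y) = ((2:ℝ) ^ (x - y)) ^ n := by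
  rw [← Real.rpow_sub (by norm_num), ← Real.rpow_natCast, ← Real.rpow_mul (by norm_num)]
  congr 1; ring

end final

section achievable
variable {S Sa Sb Xa Xb Y : Type} [Fintype S] [Fintype Sa] [Fintype Sb]
  [Fintype Xa] [Fintype Xb] [Fintype Y] [DecidableEq Sa] [DecidableEq Sb]

theorem aux_achievable (M : FSMAC S Sa Sb Xa Xb Y) (πa : (Sa → Xa) → ℝ) (πb : (Sb → Xb) → ℝ)
    (hπa : isPMF πa) (hπb : isPMF πb) (Ra Rb : ℝ) (hRa : 0 ≤ Ra) (hRb : 0 ≤ Rb)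
    (hIa : Ra < Ia M πa πb) (hIb : Rb < Ib M πa πb) (hIs : Ra + Rb < Isum M πa πb) :
    Achievable M Ra Rb := by
  classical
  obtain ⟨τa, hτa, hτa'⟩ := exists_between hIa
  obtain ⟨τb, hτb, hτb'⟩ := exists_between hIb
  obtain ⟨τc, hτc, hτc'⟩ := exists_between hIs
  rw [aux_Ia M πa πb hπa] at hτa'
  rw [aux_Ib M πa πb hπb] at hτb'
  rw [aux_Isum M πa πb hπa hπb] at hτc'
  have hP := auxP_pmf M πa πb hπa hπb
  have hpos : ∀ x, auxP M πa πb x ≠ 0 → 0 < πa x.1 ∧ 0 < πb x.2.1 ∧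
      0 < auxW M x.1 x.2.1 x.2.2.1 x.2.2.2 := by
    intro x hx
    refine ⟨lt_of_le_of_ne (hπa.1 _) fun h => hx ?_, lt_of_le_of_ne (hπb.1 _) fun h => hx ?_,
      lt_of_le_of_ne (auxW_nonneg _ _ _ _ _) fun h => hx ?_⟩ <;> simp [auxP, ← h]
  obtain ⟨ra, ra0, ra1, hra⟩ := aux_ratio (auxP M πa πb) hP
    (fun x => auxW M x.1 x.2.1 x.2.2.1 x.2.2.2)
    (fun x => ∑ ta, πa ta * auxW M ta x.2.1 x.2.2.1 x.2.2.2)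
    (fun x hx => (hpos x hx).2.2)
    (fun x hx => Finset.sum_pos' (fun a _ => mul_nonneg (hπa.1 _) (auxW_nonneg _ _ _ _ _))
      ⟨x.1, Finset.mem_univ _, mul_pos (hpos x hx).1 (hpos x hx).2.2⟩) τa hτa'
  obtain ⟨rb, rb0, rb1, hrb⟩ := aux_ratio (auxP M πa πb) hP
    (fun x => auxW M x.1 x.2.1 x.2.2.1 x.2.2.2)
    (fun x => ∑ tb, πb tb * auxW M x.1 tb x.2.2.1 x.2.2.2)
    (fun x hx => (hpos x hx).2.2)
    (fun x hx => Finset.sum_pos' (fun a _ => mul_nonneg (hπb.1 _) (auxW_nonneg _ _ _ _ _))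
      ⟨x.2.1, Finset.mem_univ _, mul_pos (hpos x hx).2.1 (hpos x hx).2.2⟩) τb hτb'
  obtain ⟨rc, rc0, rc1, hrc⟩ := aux_ratio (auxP M πa πb) hP
    (fun x => auxW M x.1 x.2.1 x.2.2.1 x.2.2.2)
    (fun x => ∑ ta, πa ta * ∑ tb, πb tb * auxW M ta tb x.2.2.1 x.2.2.2)
    (fun x hx => (hpos x hx).2.2)
    (fun x hx => Finset.sum_pos' (fun a _ => mul_nonneg (hπa.1 _)
        (Finset.sum_nonneg fun b _ => mul_nonneg (hπb.1 _) (auxW_nonneg _ _ _ _ _)))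
      ⟨x.1, Finset.mem_univ _, mul_pos (hpos x hx).1
        (Finset.sum_pos' (fun a _ => mul_nonneg (hπb.1 _) (auxW_nonneg _ _ _ _ _))
      ⟨x.2.1, Finset.mem_univ _, mul_pos (hpos x hx).2.1 (hpos x hx).2.2⟩)⟩) τc hτc'
  have two_lt : ∀ x : ℝ, x < 0 → 0 ≤ (2:ℝ) ^ x ∧ (2:ℝ) ^ x < 1 := fun x hx =>
    ⟨by positivity, Real.rpow_lt_one_of_one_lt_of_neg (by norm_num) hx⟩
  obtain ⟨ρa0, ρa1⟩ := two_lt (Ra - τa) (by linarith)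
  obtain ⟨ρb0, ρb1⟩ := two_lt (Rb - τb) (by linarith)
  obtain ⟨ρc0, ρc1⟩ := two_lt (Ra + Rb - τc) (by linarith)
  refine ⟨hRa, hRb, fun ε hε => ?_⟩
  have hlim : Filter.Tendsto (fun n : ℕ => ra ^ n + rb ^ n + rc ^ n
      + 2 * ((2:ℝ) ^ (Ra - τa)) ^ n + 2 * ((2:ℝ) ^ (Rb - τb)) ^ n
      + 4 * ((2:ℝ) ^ (Ra + Rb - τc)) ^ n) Filter.atTop (nhds 0) := by
    have h := ((((tendsto_pow_atTop_nhds_zero_of_lt_one ra0 ra1).add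
      (tendsto_pow_atTop_nhds_zero_of_lt_one rb0 rb1)).add
      (tendsto_pow_atTop_nhds_zero_of_lt_one rc0 rc1)).add
      ((tendsto_pow_atTop_nhds_zero_of_lt_one ρa0 ρa1).const_mul 2)).add
      ((tendsto_pow_atTop_nhds_zero_of_lt_one ρb0 ρb1).const_mul 2) |>.add
      ((tendsto_pow_atTop_nhds_zero_of_lt_one ρc0 ρc1).const_mul 4)
    simpa using h
  obtain ⟨N, hN⟩ := Filter.eventually_atTop.1 (hlim.eventually (gt_mem_nhds hε))
  refine ⟨max N 1, fun n hn => ?_⟩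
  have hn0 : 0 < n := lt_of_lt_of_le one_pos ((le_max_right _ _).trans hn)
  have hNn := hN n ((le_max_left _ _).trans hn)
  obtain ⟨ha1, ha2, ha3⟩ := aux_ceil n Ra hRa hn0
  obtain ⟨hb1, hb2, hb3⟩ := aux_ceil n Rb hRb hn0
  set Ma := ⌈(2:ℝ) ^ (n * Ra)⌉₊
  set Mb := ⌈(2:ℝ) ^ (n * Rb)⌉₊
  -- the n-letter objects
  let pa : (Fin n → Sa → Xa) → ℝ := fun a => ∏ t, πa (a t)
  let pb : (Fin n → Sb → Xb) → ℝ := fun b => ∏ t, πb (b t)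
  have hpa : isPMF pa := ⟨fun F => Finset.prod_nonneg fun i _ => hπa.1 _, aux_pi_sum πa hπa⟩
  have hpb : isPMF pb := ⟨fun F => Finset.prod_nonneg fun i _ => hπb.1 _, aux_pi_sum πb hπb⟩
  let W : (Fin n → Sa → Xa) → (Fin n → Sb → Xb) → (Fin n → S) × (Fin n → Y) → ℝ :=
    fun a b z => ∏ t, auxW M (a t) (b t) (z.1 t) (z.2 t)
  have hW0 : ∀ a b z, 0 ≤ W a b z := fun a b z =>
    Finset.prod_nonneg fun t _ => auxW_nonneg _ _ _ _ _
  have hW1 : ∀ a b, ∑ z, W a b z = 1 := by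
    intro a b
    rw [Fintype.sum_prod_type]
    simp only [W]
    rw [aux_pi2 (fun t s y => auxW M (a t) (b t) s y)]
    simp only [auxW_sum, Finset.prod_const_one]
  have qa : ∀ b z, ∑ a', pa a' * W a' b z
      = ∏ t, ∑ ta, πa ta * auxW M ta (b t) (z.1 t) (z.2 t) := fun b z =>
    aux_marg πa (fun t ta => auxW M ta (b t) (z.1 t) (z.2 t))
  have qb : ∀ a z, ∑ b', pb b' * W a b' z
      = ∏ t, ∑ tb, πb tb * auxW M (a t) tb (z.1 t) (z.2 t) := fun a z =>
    aux_marg πb (fun t tb => auxW M (a t) tb (z.1 t) (z.2 t))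
  have qc : ∀ z, ∑ a', pa a' * ∑ b', pb b' * W a' b' z
      = ∏ t, ∑ ta, πa ta * ∑ tb, πb tb * auxW M ta tb (z.1 t) (z.2 t) := by
    intro z
    simp only [qb]
    exact aux_marg πa (fun t ta => ∑ tb, πb tb * auxW M ta tb (z.1 t) (z.2 t))
  let Ea := fun a b z => W a b z ≤ (2:ℝ) ^ (n * τa) * ∑ a', pa a' * W a' b z
  let Eb := fun a b z => W a b z ≤ (2:ℝ) ^ (n * τb) * ∑ b', pb b' * W a b' z
  let Ec := fun a b z => W a b z ≤ (2:ℝ) ^ (n * τc) * ∑ a', pa a' * ∑ b', pb b' * W a' b' z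
  obtain ⟨F, G, dec, hdec⟩ := aux_oneshot ha1 hb1 pa pb hpa hpb W hW0 hW1
    ((2:ℝ) ^ (n * τa)) ((2:ℝ) ^ (n * τb)) ((2:ℝ) ^ (n * τc)) (by positivity) (by positivity)
    (by positivity) (fun a b z => ¬ Ea a b z ∧ ¬ Eb a b z ∧ ¬ Ec a b z)
    (fun a b z h => (not_le.1 h.1).le) (fun a b z h => (not_le.1 h.2.1).le)
    (fun a b z h => (not_le.1 h.2.2).le)
  refine ⟨Ma, Mb, auxCode M F G dec, ha2, hb2, ?_⟩
  rw [aux_err]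
  have hQ : ∀ E : (Fin n → Sa → Xa) → (Fin n → Sb → Xb) → (Fin n → S) × (Fin n → Y) → Prop,
      ∑ a, pa a * ∑ b, pb b * ∑ z, (if E a b z then W a b z else 0)
      = ∑ x : Fin n → (Sa → Xa) × (Sb → Xb) × S × Y,
        if E (fun t => (x t).1) (fun t => (x t).2.1)
          (fun t => (x t).2.2.1, fun t => (x t).2.2.2) then ∏ t, auxP M πa πb (x t) else 0 := by
    intro E
    have := aux_quad (n := n) (fun (a : Fin n → Sa → Xa) (b : Fin n → Sb → Xb) (s : Fin n → S)
      (y : Fin n → Y) => pa a * (pb b * (if E a b (s, y) then W a b (s, y) else 0)))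
    simp only [Fintype.sum_prod_type, Finset.mul_sum]
    rw [← this]
    refine Finset.sum_congr rfl fun x _ => ?_
    split_ifs
    · simp only [pa, pb, W, auxP, Finset.prod_mul_distrib]
      ring
    · simp
  have hA : ∑ a, pa a * ∑ b, pb b * ∑ z, (if Ea a b z then W a b z else 0) ≤ ra ^ n := by
    rw [hQ]
    refine hra n _ fun x hx => ?_
    simp only [Ea, qa] at hx
    exact hx
  have hB : ∑ a, pa a * ∑ b, pb b * ∑ z, (if Eb a b z then W a b z else 0) ≤ rb ^ n := by
    rw [hQ]
    refine hrb n _ fun x hx => ?_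
    simp only [Eb, qb] at hx
    exact hx
  have hC : ∑ a, pa a * ∑ b, pb b * ∑ z, (if Ec a b z then W a b z else 0) ≤ rc ^ n := by
    rw [hQ]
    refine hrc n _ fun x hx => ?_
    simp only [Ec, qc] at hx
    exact hx
  have hP0 : ∑ a, pa a * ∑ b, pb b * ∑ z,
      (if ¬ Ea a b z ∧ ¬ Eb a b z ∧ ¬ Ec a b z then 0 else W a b z)
      ≤ ra ^ n + rb ^ n + rc ^ n := by
    refine le_trans ?_ (add_le_add (add_le_add hA hB) hC)
    simp only [← Finset.sum_add_distrib, ← mul_add]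
    refine Finset.sum_le_sum fun a _ => mul_le_mul_of_nonneg_left
      (Finset.sum_le_sum fun b _ => mul_le_mul_of_nonneg_left
        (Finset.sum_le_sum fun z _ => ?_) (hpb.1 _)) (hpa.1 _)
    have := hW0 a b z
    by_cases h1 : Ea a b z <;> by_cases h2 : Eb a b z <;> by_cases h3 : Ec a b z <;>
      simp [h1, h2, h3] <;> linarith
  have hta : (Ma : ℝ) / (2:ℝ) ^ (n * τa) ≤ 2 * ((2:ℝ) ^ (Ra - τa)) ^ n := by
    rw [← aux_pow, ← mul_div_assoc]
    exact div_le_div_of_nonneg_right ha3 (by positivity)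
  have htb : (Mb : ℝ) / (2:ℝ) ^ (n * τb) ≤ 2 * ((2:ℝ) ^ (Rb - τb)) ^ n := by
    rw [← aux_pow, ← mul_div_assoc]
    exact div_le_div_of_nonneg_right hb3 (by positivity)
  have htc : (Ma : ℝ) * Mb / (2:ℝ) ^ (n * τc) ≤ 4 * ((2:ℝ) ^ (Ra + Rb - τc)) ^ n := by
    rw [← aux_pow, ← mul_div_assoc]
    refine div_le_div_of_nonneg_right ?_ (by positivity)
    rw [mul_add, Real.rpow_add (by norm_num)]
    calc (Ma : ℝ) * Mb ≤ (2 * (2:ℝ) ^ (n * Ra)) * (2 * (2:ℝ) ^ (n * Rb)) :=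
          mul_le_mul ha3 hb3 (by positivity) (by positivity)
      _ = _ := by ring
  refine le_trans (le_of_eq ?_) (hdec.trans ?_)
  · congr!
  · refine le_trans (le_of_eq_of_le ?_ (add_le_add (add_le_add (add_le_add hP0 hta) htb) htc)) hNn.le
    congr!

end achievable

/-- For every memoryless stationary team policy `π = (πa, πb)`, every rate pair in
`ℛ(π)` is achievable for the memoryless FS-MAC with i.i.d. state, causal asymmetric
noisy CSIT and complete CSIR; i.e. `ℛ(π) ⊆ C_FS`. -/
theorem rateRegion_achievable {S Sa Sb Xa Xb Y : Type} [Fintype S] [Fintype Sa]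
    [Fintype Sb] [Fintype Xa] [Fintype Xb] [Fintype Y] [DecidableEq Sa] [DecidableEq Sb]
    (M : FSMAC S Sa Sb Xa Xb Y) (πa : (Sa → Xa) → ℝ) (πb : (Sb → Xb) → ℝ)
    (hπa : isPMF πa) (hπb : isPMF πb) :
    (∀ R ∈ rateRegion M πa πb, Achievable M R.1 R.2) ∧
      rateRegion M πa πb ⊆ capRegion M := by
  classical
  have hmain : ∀ R ∈ rateRegion M πa πb, Achievable M R.1 R.2 := by
    rintro ⟨Ra, Rb⟩ ⟨hRa, hRb, hIa, hIb, hIs⟩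
    exact aux_achievable M πa πb hπa hπb Ra Rb hRa hRb hIa hIb hIs
  exact ⟨hmain, fun R hR => subset_closure (hmain R hR)⟩
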